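/- Let p = (p_i)_{i∈ℕ} be a probability distribution on ℕ, X^n a sample of n i.i.d. observations from p, and p̂ the maximum likelihood estimator. Put v_i = p_i(1−p_i), v* = sup_{i∈ℕ} v_i, V* = sup_{i∈ℕ} v_i(p↓)·log(i+1) where p↓ is a nonincreasing rearrangement of p, and φ(t) = t·log(1/t) for t ∈ [0,1]. Then for every n ≥ 81 and δ ∈ (0,1), with probability at least 1 − δ − 81/n, the following chain of bounds holds: sup_{i∈ℕ} |p_i − p̂_i| ≤ 2√( V*/n + (v*/n)·log(2/δ) ) + (4/(3n))·log(2(n+1)/δ) + log(n)/n ≤ 2√( φ(v*)/n + (v*/n)·log(2/δ) ) + (4/(3n))·log(2(n+1)/δ) + log(n)/n, and moreover sup_{i∈ℕ} |p_i − p̂_i| ≤ 2√( v*·log(n+1)/n + (v*/n)·log(2/δ) ) + (4/(3n))·log(2(n+1)/δ) + log(n)/n. -/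

import Mathlib

open MeasureTheory Real Filter

noncomputable def sampleMeasure (p : PMF ℕ) (n : ℕ) : Measure (Fin n → ℕ) :=
  MeasureTheory.Measure.pi fun _ => p.toMeasure

noncomputable def mle (n : ℕ) (x : Fin n → ℕ) (i : ℕ) : ℝ :=
  ((Finset.univ.filter fun j => x j = i).card : ℝ) / n


noncomputable def supErr (p : PMF ℕ) (n : ℕ) (x : Fin n → ℕ) : ℝ :=
  ⨆ i : ℕ, |(p i).toReal - mle n x i|

noncomputable def vstar (p : PMF ℕ) : ℝ :=
  ⨆ i : ℕ, (p i).toReal * (1 - (p i).toReal)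

/-- `V*(p)` computed from a nonincreasing rearrangement `i ↦ p (e i)` of `p`
(indices are 0-based, so the `i`-th largest mass gets weight `log (i+2)`). -/
noncomputable def Vstar (p : PMF ℕ) (e : ℕ ≃ ℕ) : ℝ :=
  ⨆ i : ℕ, ((p (e i)).toReal * (1 - (p (e i)).toReal)) * Real.log ((i : ℝ) + 2)

lemma aux_fact (m : ℕ) : (2 : ℝ) * 3 ^ m ≤ 9 * (m.factorial : ℝ) := by
  have h : 2 * 3 ^ m ≤ 9 * m.factorial := by
    match m with
    | 0 => norm_num
    | 1 => norm_num
    | k + 2 =>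
      induction k with
      | zero => norm_num
      | succ k ih =>
        rw [show k + 1 + 2 = (k + 2) + 1 by ring, Nat.factorial_succ, pow_succ]
        nlinarith [Nat.factorial_pos (k + 2)]
  exact_mod_cast h

lemma aux_exp (z l : ℝ) (hz : |z| ≤ l) (hl : l < 3) :
    Real.exp z ≤ 1 + z + z ^ 2 / (2 * (1 - l / 3)) := by
  have h1 : HasSum (fun n : ℕ => z ^ n / (n.factorial : ℝ)) (Real.exp z) := by
    have := NormedSpace.expSeries_div_hasSum_exp z
    rwa [← Real.exp_eq_exp_ℝ] at this
  have h2 := (hasSum_nat_add_iff' 2).2 h1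
  have hl0 : 0 ≤ l := (abs_nonneg z).trans hz
  have h3 : HasSum (fun n : ℕ => z ^ 2 / 2 * (l / 3) ^ n) (z ^ 2 / 2 * (1 - l / 3)⁻¹) :=
    (hasSum_geometric_of_lt_one (by positivity) (by linarith)).mul_left _
  have h4 := hasSum_le (fun n => ?_) h2 h3
  · simp [Finset.sum_range_succ] at h4
    have : z ^ 2 / (2 * (1 - l / 3)) = z ^ 2 / 2 * (1 - l / 3)⁻¹ := by
      have : 1 - l / 3 ≠ 0 := by linarith
      field_simp
    linarith
  · have hf := aux_fact (n + 2)
    have hz1 : z ^ (n + 2) ≤ z ^ 2 * l ^ n := by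
      rw [pow_add, mul_comm]
      apply mul_le_mul_of_nonneg_left _ (sq_nonneg z)
      calc z ^ n ≤ |z ^ n| := le_abs_self _
        _ = |z| ^ n := abs_pow _ _
        _ ≤ l ^ n := pow_le_pow_left₀ (abs_nonneg _) hz _
    rw [div_le_iff₀ (by positivity)]
    have h5 : (3 : ℝ) ^ n * 2 ≤ ((n + 2).factorial : ℝ) := by
      rw [pow_add] at hf; linarith
    have h6 : z ^ 2 / 2 * (l / 3) ^ n * (3 ^ n * 2) = z ^ 2 * l ^ n := by
      rw [div_pow]; field_simp
    calc _ ≤ z ^ 2 * l ^ n := hz1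
      _ = z ^ 2 / 2 * (l / 3) ^ n * (3 ^ n * 2) := h6.symm
      _ ≤ _ := by gcongr

instance aux_inst (p : PMF ℕ) (n : ℕ) : IsProbabilityMeasure (sampleMeasure p n) := by
  unfold sampleMeasure; infer_instance

lemma aux_chernoff (p : PMF ℕ) (n : ℕ) (f : ℕ → ℝ) (M s : ℝ)
    (hi : Integrable (fun k => Real.exp (f k)) p.toMeasure)
    (hM : ∫ k, Real.exp (f k) ∂p.toMeasure ≤ Real.exp M) :
    (sampleMeasure p n).real {x | s ≤ ∑ j, f (x j)} ≤ Real.exp (n * M - s) := by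
  have h1 : ∫ x, ∏ j, Real.exp (f (x j)) ∂(sampleMeasure p n) =
      (∫ k, Real.exp (f k) ∂p.toMeasure) ^ n := by
    unfold sampleMeasure
    rw [integral_fintype_prod_eq_prod (fun (_ : Fin n) k => Real.exp (f k))]
    simp
  have hint : Integrable (fun x : Fin n → ℕ => ∏ j, Real.exp (f (x j))) (sampleMeasure p n) := by
    unfold sampleMeasure
    exact Integrable.fintype_prod (fun _ => hi)
  have h2 := mul_meas_ge_le_integral_of_nonneg (μ := sampleMeasure p n)
    (f := fun x => ∏ j, Real.exp (f (x j)))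
    (Filter.Eventually.of_forall fun x => Finset.prod_nonneg fun j _ => (Real.exp_pos _).le)
    hint (Real.exp s)
  rw [h1] at h2
  have h3 : {x : Fin n → ℕ | Real.exp s ≤ ∏ j, Real.exp (f (x j))} = {x | s ≤ ∑ j, f (x j)} := by
    ext x; simp [← Real.exp_sum]
  rw [h3] at h2
  have h4 : (∫ k, Real.exp (f k) ∂p.toMeasure) ^ n ≤ Real.exp (n * M) := by
    rw [Real.exp_nat_mul]
    exact pow_le_pow_left₀ (integral_nonneg fun _ => (Real.exp_pos _).le) hM _
  rw [Real.exp_sub, le_div_iff₀ (Real.exp_pos _)]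
  linarith

lemma aux_le_one (p : PMF ℕ) (i : ℕ) : (p i).toReal ≤ 1 := by
  simpa using ENNReal.toReal_mono ENNReal.one_ne_top (p.coe_le_one i)

lemma aux_int (p : PMF ℕ) (i : ℕ) (a b : ℝ) :
    Integrable (fun k => if k = i then a else b) p.toMeasure ∧
    ∫ k, (if k = i then a else b) ∂p.toMeasure =
      (p i).toReal * a + (1 - (p i).toReal) * b := by
  have h : (fun k => if k = i then a else b) = fun k => ({i} : Set ℕ).indicator (fun _ => a - b) k + b := by
    ext k; by_cases hk : k = i <;> simp [hk]
  have hI : Integrable (({i} : Set ℕ).indicator (fun _ => a - b)) p.toMeasure :=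
    (integrable_const _).indicator (measurableSet_singleton _)
  rw [h]
  refine ⟨hI.add (integrable_const _), ?_⟩
  rw [integral_add hI (integrable_const _), integral_indicator (measurableSet_singleton _)]
  simp [Measure.real, PMF.toMeasure_apply_singleton]
  ring

lemma aux_mgf (p : PMF ℕ) (i : ℕ) (l : ℝ) (hl : |l| < 3) :
    Integrable (fun k => Real.exp (l * ((if k = i then 1 else 0) - (p i).toReal))) p.toMeasure ∧
    ∫ k, Real.exp (l * ((if k = i then 1 else 0) - (p i).toReal)) ∂p.toMeasure ≤
      Real.exp ((p i).toReal * (1 - (p i).toReal) * (l ^ 2 / (2 * (1 - |l| / 3)))) := by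
  set q := (p i).toReal with hq
  have hq0 : 0 ≤ q := ENNReal.toReal_nonneg
  have hq1 : q ≤ 1 := aux_le_one p i
  have h : (fun k => Real.exp (l * ((if k = i then 1 else 0) - q))) =
      fun k => if k = i then Real.exp (l * (1 - q)) else Real.exp (l * (- q)) := by
    ext k; by_cases hk : k = i <;> simp [hk]
  rw [h]
  obtain ⟨h1, h2⟩ := aux_int p i (Real.exp (l * (1 - q))) (Real.exp (l * (- q)))
  refine ⟨h1, ?_⟩
  rw [h2, ← hq]
  have e1 := aux_exp (l * (1 - q)) |l| (by
    rw [abs_mul, abs_of_nonneg (by linarith : 0 ≤ 1 - q)]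
    nlinarith [abs_nonneg l]) hl
  have e2 := aux_exp (l * (- q)) |l| (by
    rw [abs_mul, abs_neg, abs_of_nonneg hq0]
    nlinarith [abs_nonneg l]) hl
  refine le_trans ?_ (Real.add_one_le_exp _)
  have m1 := mul_le_mul_of_nonneg_left e1 hq0
  have m2 := mul_le_mul_of_nonneg_left e2 (by linarith : 0 ≤ 1 - q)
  refine (add_le_add m1 m2).trans (le_of_eq ?_)
  have : 1 - |l| / 3 ≠ 0 := by linarith
  field_simp
  ring

lemma aux_sum (p : PMF ℕ) (n : ℕ) (hn : 0 < n) (i : ℕ) (x : Fin n → ℕ) (l : ℝ) :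
    ∑ j, l * ((if x j = i then 1 else 0) - (p i).toReal) =
      l * (n * (mle n x i - (p i).toReal)) := by
  rw [← Finset.mul_sum, Finset.sum_sub_distrib, mle]
  have : (n : ℝ) ≠ 0 := by positivity
  simp
  field_simp
  simp

lemma aux_bern (p : PMF ℕ) (n : ℕ) (hn : 0 < n) (i : ℕ) (t σ : ℝ) (ht : 0 < t) (hσ : 0 ≤ σ)
    (hv : n * ((p i).toReal * (1 - (p i).toReal)) = 2 * t * σ ^ 2) :
    (sampleMeasure p n).real {x | (2 * t * σ + 2 * t / 3) < n * |(p i).toReal - mle n x i|} ≤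
      2 * Real.exp (-t) := by
  set l : ℝ := 1 / (2 / 3 + σ) with hl
  have hl0 : 0 < l := by positivity
  have hl3 : l < 3 := by
    rw [hl, div_lt_iff₀ (by positivity)]; linarith
  have key : n * ((p i).toReal * (1 - (p i).toReal) * (l ^ 2 / (2 * (1 - l / 3))))
      - l * (2 * t * σ + 2 * t / 3) ≤ -t := by
    rw [← mul_assoc, hv]
    have h1 : 1 - l / 3 = (σ + 1 / 3) / (σ + 2 / 3) := by
      rw [hl]; field_simp; ring
    rw [h1, hl]
    have : t * (σ / 3 / ((σ + 2 / 3) * (σ + 1 / 3))) ≥ 0 := by positivity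
    have h2 : -t - (2 * t * σ ^ 2 * ((1 / (2 / 3 + σ)) ^ 2 / (2 * ((σ + 1 / 3) / (σ + 2 / 3)))) -
      1 / (2 / 3 + σ) * (2 * t * σ + 2 * t / 3)) = t * (σ / 3 / ((σ + 2 / 3) * (σ + 1 / 3))) := by
      have : 2 / 3 + σ ≠ 0 := by positivity
      have : σ + 2 / 3 ≠ 0 := by positivity
      have : σ + 1 / 3 ≠ 0 := by positivity
      rw [show 2 / 3 + σ = σ + 2 / 3 by ring]
      field_simp
      ring
    linarith
  have habs : |l| = l := abs_of_pos hl0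
  obtain ⟨a1, a2⟩ := aux_mgf p i l (by rwa [habs])
  obtain ⟨b1, b2⟩ := aux_mgf p i (-l) (by rwa [abs_neg, habs])
  rw [habs] at a2
  rw [abs_neg, habs, neg_sq] at b2
  have c1 := aux_chernoff p n _ _ (l * (2 * t * σ + 2 * t / 3)) a1 a2
  have c2 := aux_chernoff p n _ _ (l * (2 * t * σ + 2 * t / 3)) b1 b2
  simp only [aux_sum p n hn] at c1 c2
  have hk := Real.exp_le_exp.2 key
  calc _ ≤ (sampleMeasure p n).real
        ({x | l * (2 * t * σ + 2 * t / 3) ≤ l * (n * (mle n x i - (p i).toReal))} ∪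
         {x | l * (2 * t * σ + 2 * t / 3) ≤ -l * (n * (mle n x i - (p i).toReal))}) := by
        apply measureReal_mono _ (measure_ne_top _ _)
        intro x hx
        simp only [Set.mem_ofPred_eq, Set.mem_union] at hx ⊢
        rcases le_total 0 ((p i).toReal - mle n x i) with h | h
        · right
          rw [abs_of_nonneg h] at hx
          nlinarith
        · left
          rw [abs_of_nonpos h] at hx
          nlinarith
    _ ≤ _ := measureReal_union_le _ _
    _ ≤ _ := by linarith

lemma aux_tail (p : PMF ℕ) (n m i : ℕ) :
    sampleMeasure p n {x | m ≤ (Finset.univ.filter fun j => x j = i).card} ≤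
      (n.choose m : ENNReal) * p i ^ m := by
  classical
  calc _ ≤ sampleMeasure p n (⋃ S ∈ Finset.powersetCard m (Finset.univ : Finset (Fin n)),
        Set.pi Set.univ (fun j => if j ∈ S then ({i} : Set ℕ) else Set.univ)) := by
        apply measure_mono
        intro x hx
        obtain ⟨S, hS, hc⟩ := Finset.exists_subset_card_eq hx
        simp only [Set.mem_iUnion]
        refine ⟨S, by simp [hc], ?_⟩
        intro j _
        by_cases hj : j ∈ S
        · have := hS hj
          simp at this
          simp [hj, this]
        · simp [hj]
    _ ≤ ∑ S ∈ Finset.powersetCard m (Finset.univ : Finset (Fin n)), p i ^ m := by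
        refine (measure_biUnion_finset_le _ _).trans (Finset.sum_le_sum fun S hS => ?_)
        unfold sampleMeasure
        rw [Measure.pi_pi]
        have : ∀ j : Fin n, p.toMeasure (if j ∈ S then ({i} : Set ℕ) else Set.univ) =
            if j ∈ S then p i else 1 := by
          intro j; split_ifs <;> simp [PMF.toMeasure_apply_singleton]
        simp only [this]
        rw [Finset.prod_ite]
        simp [(Finset.mem_powersetCard.1 hS).2]
    _ = _ := by simp

lemma aux_rank (p : PMF ℕ) (e : ℕ ≃ ℕ) (he : Antitone fun i => (p (e i)).toReal) (k : ℕ) :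
    (p (e k)).toReal ≤ 1 / (k + 1) := by
  have hs : HasSum (fun i => (p i).toReal) 1 := by
    have h := ENNReal.hasSum_toReal (f := fun i => p i) (by rw [p.tsum_coe]; simp)
    rw [← ENNReal.tsum_toReal_eq (fun i => p.apply_ne_top i), p.tsum_coe] at h; simpa using h
  have hs2 : HasSum (fun i => (p (e i)).toReal) 1 := e.hasSum_iff.2 hs
  have h1 := sum_le_hasSum (Finset.range (k + 1)) (fun i _ => ENNReal.toReal_nonneg) hs2
  have h2 : ∑ i ∈ Finset.range (k + 1), (p (e k)).toReal ≤
      ∑ i ∈ Finset.range (k + 1), (p (e i)).toReal := by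
    refine Finset.sum_le_sum fun i hi => he ?_
    have := Finset.mem_range.1 hi
    omega
  simp at h2
  rw [le_div_iff₀ (by positivity)]
  linarith

lemma aux_bdd (p : PMF ℕ) (i : ℕ) : (p i).toReal * (1 - (p i).toReal) ≤ 1 / 4 := by
  nlinarith [sq_nonneg ((p i).toReal - 1 / 2)]

lemma aux_vnn (p : PMF ℕ) (i : ℕ) : 0 ≤ (p i).toReal * (1 - (p i).toReal) :=
  mul_nonneg ENNReal.toReal_nonneg (by linarith [aux_le_one p i])

lemma aux_bdd' (p : PMF ℕ) :
    BddAbove (Set.range fun i : ℕ => (p i).toReal * (1 - (p i).toReal)) :=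
  ⟨1 / 4, by rintro _ ⟨i, rfl⟩; exact aux_bdd p i⟩

lemma aux_v_le (p : PMF ℕ) (i : ℕ) : (p i).toReal * (1 - (p i).toReal) ≤ vstar p :=
  le_ciSup (aux_bdd' p) i

lemma aux_vstar_le (p : PMF ℕ) : vstar p ≤ 1 / 4 := ciSup_le (aux_bdd p)

lemma aux_phi (a b : ℝ) (ha : 0 < a) (hab : a ≤ b) (hb : b ≤ 1 / 4) :
    a * Real.log (1 / a) ≤ b * Real.log (1 / b) := by
  have hb0 : 0 < b := ha.trans_le hab
  -- log(b/a) ≤ b/a - 1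
  have h1 := Real.log_le_sub_one_of_pos (show 0 < b / a by positivity)
  rw [Real.log_div hb0.ne' ha.ne'] at h1
  have h2 : a * (Real.log b - Real.log a) ≤ b - a := by
    calc _ ≤ a * (b / a - 1) := by gcongr
      _ = b - a := by field_simp
  have h3 : 1 ≤ Real.log (1 / b) := by
    rw [Real.le_log_iff_exp_le (by positivity)]
    have : Real.exp 1 < 4 := by linarith [Real.exp_one_lt_d9]
    have : 4 ≤ 1 / b := by rw [le_div_iff₀ hb0]; linarith
    linarith
  simp only [one_div, Real.log_inv] at *
  nlinarith

lemma aux_V_term (p : PMF ℕ) (e : ℕ ≃ ℕ) (he : Antitone fun i => (p (e i)).toReal) (k : ℕ) :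
    ((p (e k)).toReal * (1 - (p (e k)).toReal)) * Real.log ((k : ℝ) + 2) ≤
      vstar p * Real.log (1 / vstar p) := by
  have hv0 := aux_vnn p (e k)
  have hv1 := aux_bdd p (e k)
  have hvs := aux_v_le p (e k)
  have hr := aux_rank p e he k
  have hq0 : 0 ≤ (p (e k)).toReal := ENNReal.toReal_nonneg
  set q := (p (e k)).toReal
  rcases hv0.eq_or_lt with h0 | h0
  · rw [← h0, zero_mul]
    have : 0 ≤ vstar p := hv0.trans hvs
    rcases this.eq_or_lt with h | h
    · rw [← h]; simp
    · exact mul_nonneg h.le (Real.log_nonneg (by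
        rw [le_div_iff₀ h]; linarith [aux_vstar_le p]))
  · refine le_trans ?_ (aux_phi _ _ h0 hvs (aux_vstar_le p))
    apply mul_le_mul_of_nonneg_left _ h0.le
    apply Real.log_le_log (by positivity)
    rw [le_div_iff₀ h0]
    rcases Nat.eq_zero_or_pos k with rfl | hk
    · norm_num; linarith
    · have hk1 : (1 : ℝ) ≤ k := by exact_mod_cast hk
      have hr2 : q * (k + 1) ≤ 1 := by rwa [le_div_iff₀ (by positivity)] at hr
      set w := q * (k + 1) with hw
      -- (k+2) q (1-q) ≤ 1
      have hqw : q = w / (k + 1) := by rw [hw]; field_simp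
      have hw0 : 0 ≤ w := by positivity
      rw [hqw]
      have : ((k : ℝ) + 2) * (w / (k + 1) * (1 - w / (k + 1))) =
        ((k + 2) * w * (k + 1 - w)) / (k + 1) ^ 2 := by field_simp
      rw [this, div_le_one (by positivity)]
      nlinarith [mul_nonneg (sub_nonneg.2 hr2) hw0, mul_nonneg (sub_nonneg.2 hr2) (by linarith : (0:ℝ) ≤ k), mul_nonneg (mul_nonneg (sub_nonneg.2 hr2) (by linarith : (0:ℝ) ≤ k)) (by linarith : (0:ℝ) ≤ k), mul_nonneg (mul_nonneg (sub_nonneg.2 hr2) (by linarith : (0:ℝ) ≤ k)) hw0]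

lemma aux_V_le (p : PMF ℕ) (e : ℕ ≃ ℕ) (he : Antitone fun i => (p (e i)).toReal) (k : ℕ) :
    ((p (e k)).toReal * (1 - (p (e k)).toReal)) * Real.log ((k : ℝ) + 2) ≤ Vstar p e :=
  le_ciSup (f := fun k : ℕ => ((p (e k)).toReal * (1 - (p (e k)).toReal)) * Real.log ((k : ℝ) + 2))
    ⟨_, by rintro _ ⟨i, rfl⟩; exact aux_V_term p e he i⟩ k

lemma aux_V_phi (p : PMF ℕ) (e : ℕ ≃ ℕ) (he : Antitone fun i => (p (e i)).toReal) :
    Vstar p e ≤ vstar p * Real.log (1 / vstar p) := ciSup_le (aux_V_term p e he)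

lemma aux_fact2 (n : ℕ) (hn : 81 ≤ n) (m : ℕ) (hm : 2 * Real.log n ≤ m) :
    (n : ℝ) ^ 2 ≤ 81 * (m.factorial : ℝ) := by
  have hn0 : (0 : ℝ) < n := by positivity
  have h1 : (n : ℝ) ^ 2 ≤ Real.exp m := by
    rw [← Real.exp_log (by positivity : (0 : ℝ) < (n : ℝ) ^ 2), Real.exp_le_exp, Real.log_pow]
    exact_mod_cast hm
  have h2 : Real.exp m ≤ 3 ^ m := by
    rw [← Real.exp_one_pow]
    exact pow_le_pow_left₀ (Real.exp_pos _).le (by linarith [Real.exp_one_lt_d9]) _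
  have := aux_fact m
  have : (0 : ℝ) < m.factorial := by positivity
  linarith

lemma aux_tail2 (p : PMF ℕ) (n : ℕ) (hn : 81 ≤ n) (e : ℕ ≃ ℕ)
    (he : Antitone fun i => (p (e i)).toReal) :
    sampleMeasure p n {x | ∃ k, n ≤ k ∧ 2 * Real.log n < n * mle n x (e k)} ≤
      ENNReal.ofReal (81 / n) := by
  have hn0 : (0 : ℝ) < n := by positivity
  have hlog : 0 < Real.log n := Real.log_pos (by exact_mod_cast (by omega : 1 < n))
  set m := ⌈2 * Real.log n⌉₊ with hm
  have hm1 : 2 * Real.log n ≤ m := Nat.le_ceil _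
  have hm0 : m ≠ 0 := by
    intro h; rw [h] at hm1; norm_num at hm1; linarith
  obtain ⟨r, hr⟩ := Nat.exists_eq_succ_of_ne_zero hm0
  have hf := aux_fact2 n hn m hm1
  have hk : ∀ k, sampleMeasure p n {x | n ≤ k ∧ 2 * Real.log n < n * mle n x (e k)} ≤
      ENNReal.ofReal (81 / n) * p (e k) := by
    intro k
    by_cases hnk : n ≤ k
    · have h1 : sampleMeasure p n {x | n ≤ k ∧ 2 * Real.log n < n * mle n x (e k)} ≤
          (n.choose m : ENNReal) * p (e k) ^ m := by
        refine (measure_mono ?_).trans (aux_tail p n m (e k))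
        rintro x ⟨_, hx⟩
        simp only [Set.mem_ofPred_eq]
        rw [mle, mul_div_cancel₀ _ hn0.ne'] at hx
        exact Nat.ceil_le.2 hx.le
      refine h1.trans ?_
      rw [hr, Nat.succ_eq_add_one, pow_succ, ← mul_assoc]
      gcongr
      have hpne : p (e k) ≠ ⊤ := p.apply_ne_top _
      rw [← ENNReal.ofReal_toReal hpne, ← ENNReal.ofReal_pow ENNReal.toReal_nonneg,
        ← ENNReal.ofReal_natCast, ← ENNReal.ofReal_mul (by positivity)]
      apply ENNReal.ofReal_le_ofReal
      have hp : (p (e k)).toReal ≤ 1 / n := by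
        refine (aux_rank p e he k).trans ?_
        apply one_div_le_one_div_of_le hn0
        have : (n : ℝ) ≤ k := by exact_mod_cast hnk
        linarith
      have hc : (n.choose (r + 1) : ℝ) ≤ (n : ℝ) ^ (r + 1) / ((r + 1).factorial : ℝ) :=
        Nat.choose_le_pow_div _ _
      rw [hr, Nat.succ_eq_add_one] at hf
      calc (n.choose (r + 1) : ℝ) * (p (e k)).toReal ^ r
          ≤ (n : ℝ) ^ (r + 1) / ((r + 1).factorial : ℝ) * (1 / n) ^ r := by
            gcongr
        _ = n / ((r + 1).factorial : ℝ) := by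
            rw [pow_succ, div_pow, one_pow]; field_simp
        _ ≤ 81 / n := by
            rw [div_le_div_iff₀ (by positivity) hn0]; linarith
    · simp [hnk]
  calc _ = sampleMeasure p n (⋃ k, {x | n ≤ k ∧ 2 * Real.log n < n * mle n x (e k)}) := by
        congr 1; ext x; simp
    _ ≤ ∑' k, sampleMeasure p n {x | n ≤ k ∧ 2 * Real.log n < n * mle n x (e k)} :=
        measure_iUnion_le _
    _ ≤ ∑' k, ENNReal.ofReal (81 / n) * p (e k) := ENNReal.tsum_le_tsum hk
    _ = _ := by
        rw [ENNReal.tsum_mul_left, e.tsum_eq (fun i => p i), p.tsum_coe, mul_one]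

lemma aux_tele (n : ℕ) : ∑ k ∈ Finset.range n, (1 : ℝ) / ((k + 1) * (k + 2)) = 1 - 1 / (n + 1) := by
  induction n with
  | zero => simp
  | succ n ih =>
    rw [Finset.sum_range_succ, ih]; push_cast; field_simp; ring

/-- the deviation level -/
noncomputable def auxLev (p : PMF ℕ) (n : ℕ) (δ : ℝ) (e : ℕ ≃ ℕ) (k : ℕ) : ℝ :=
  Real.sqrt (2 * n * ((p (e k)).toReal * (1 - (p (e k)).toReal)) *
    Real.log (2 * ((k + 1) * (k + 2)) / δ)) + 2 * Real.log (2 * ((k + 1) * (k + 2)) / δ) / 3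

lemma aux_head (p : PMF ℕ) (n : ℕ) (hn : 0 < n) (δ : ℝ) (hδ : δ ∈ Set.Ioo (0 : ℝ) 1)
    (e : ℕ ≃ ℕ) :
    (sampleMeasure p n).real {x | ∃ k, k < n ∧
      auxLev p n δ e k < n * |(p (e k)).toReal - mle n x (e k)|} ≤ δ := by
  obtain ⟨hδ0, hδ1⟩ := hδ
  have hk : ∀ k : ℕ, (sampleMeasure p n).real
      {x | auxLev p n δ e k < n * |(p (e k)).toReal - mle n x (e k)|} ≤
      δ * (1 / ((k + 1) * (k + 2))) := by
    intro k
    have hpos : (0 : ℝ) < 2 * ((k + 1) * (k + 2)) / δ := by positivity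
    have h1 : 1 < 2 * ((k + 1) * (k + 2)) / δ := by
      rw [lt_div_iff₀ hδ0]
      nlinarith [(Nat.cast_nonneg k : (0 : ℝ) ≤ k)]
    have ht := Real.log_pos h1
    have hexp := Real.exp_log hpos
    set t := Real.log (2 * ((k + 1) * (k + 2)) / δ) with htd
    set v := (p (e k)).toReal * (1 - (p (e k)).toReal) with hv
    have hv0 : 0 ≤ v := aux_vnn p (e k)
    have hb := aux_bern p n hn (e k) t (Real.sqrt (n * v / (2 * t))) ht (Real.sqrt_nonneg _) (by
      rw [Real.sq_sqrt (by positivity), ← hv]; field_simp)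
    have hs : 2 * t * Real.sqrt (n * v / (2 * t)) = Real.sqrt (2 * n * v * t) := by
      rw [← Real.sqrt_sq (by positivity : 0 ≤ 2 * t), ← Real.sqrt_mul (by positivity)]
      rw [Real.sqrt_sq (by positivity : 0 ≤ 2 * t)]
      congr 1; field_simp
    rw [hs, Real.exp_neg, hexp] at hb
    refine hb.trans (le_of_eq ?_)
    field_simp
  calc _ = (sampleMeasure p n).real (⋃ k ∈ Finset.range n,
        {x | auxLev p n δ e k < n * |(p (e k)).toReal - mle n x (e k)|}) := by
        congr 1; ext x; simp
    _ ≤ ∑ k ∈ Finset.range n, (sampleMeasure p n).real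
        {x | auxLev p n δ e k < n * |(p (e k)).toReal - mle n x (e k)|} :=
        measureReal_biUnion_finset_le _ _
    _ ≤ ∑ k ∈ Finset.range n, δ * (1 / ((k + 1) * (k + 2))) := Finset.sum_le_sum fun k _ => hk k
    _ ≤ δ := by
        rw [← Finset.mul_sum, aux_tele]
        have : (0 : ℝ) ≤ 1 / (n + 1) := by positivity
        nlinarith

lemma aux_logs (n : ℕ) (δ : ℝ) (hδ : δ ∈ Set.Ioo (0 : ℝ) 1) (k : ℕ) (hk : k < n) :
    Real.log (2 * ((k + 1) * (k + 2)) / δ) ≤ 2 * Real.log (k + 2) + Real.log (2 / δ) ∧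
    Real.log (2 * ((k + 1) * (k + 2)) / δ) ≤ 2 * Real.log (2 * (n + 1) / δ) := by
  obtain ⟨hδ0, hδ1⟩ := hδ
  have hkn : (k : ℝ) + 1 ≤ n := by exact_mod_cast hk
  have h1 : Real.log (2 * ((k + 1) * (k + 2)) / δ) ≤ 2 * Real.log (k + 2) + Real.log (2 / δ) := by
    have : 2 * Real.log ((k : ℝ) + 2) + Real.log (2 / δ) = Real.log ((k + 2) ^ 2 * (2 / δ)) := by
      rw [Real.log_mul (by positivity) (by positivity), Real.log_pow]; norm_num
    rw [this]
    apply Real.log_le_log (by positivity)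
    rw [mul_div_assoc', div_le_div_iff_of_pos_right hδ0]
    nlinarith [(Nat.cast_nonneg k : (0 : ℝ) ≤ k)]
  refine ⟨h1, h1.trans ?_⟩
  have h2 : Real.log (2 * (n + 1) / δ) = Real.log (n + 1) + Real.log (2 / δ) := by
    rw [← Real.log_mul (by positivity) (by positivity)]
    congr 1; ring
  have h3 : Real.log (k + 2) ≤ Real.log (n + 1) := Real.log_le_log (by positivity) (by linarith)
  have h4 : 0 ≤ Real.log (2 / δ) := Real.log_nonneg (by rw [le_div_iff₀ hδ0]; linarith)
  linarith

lemma aux_lev_le (p : PMF ℕ) (n : ℕ) (hn : 0 < n) (δ : ℝ) (hδ : δ ∈ Set.Ioo (0 : ℝ) 1)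
    (e : ℕ ≃ ℕ) (k : ℕ) (hk : k < n) (W d : ℝ)
    (hW : ((p (e k)).toReal * (1 - (p (e k)).toReal)) * Real.log ((k : ℝ) + 2) ≤ W)
    (hd : n * d ≤ auxLev p n δ e k) :
    d ≤ 2 * Real.sqrt (W / n + vstar p / n * Real.log (2 / δ)) +
              4 / (3 * n) * Real.log (2 * (n + 1) / δ) := by
  have hn0 : (0 : ℝ) < n := by exact_mod_cast hn
  obtain ⟨h1, h2⟩ := aux_logs n δ hδ k hk
  have hL : 0 ≤ Real.log (2 / δ) :=
    Real.log_nonneg (by rw [le_div_iff₀ hδ.1]; linarith [hδ.2])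
  unfold auxLev at hd
  have hv0 := aux_vnn p (e k)
  have hvs := aux_v_le p (e k)
  set v := (p (e k)).toReal * (1 - (p (e k)).toReal)
  set t := Real.log (2 * ((k + 1) * (k + 2)) / δ)
  have hsq : Real.sqrt (2 * n * v * t) ≤
      n * (2 * Real.sqrt (W / n + vstar p / n * Real.log (2 / δ))) := by
    have : n * (2 * Real.sqrt (W / n + vstar p / n * Real.log (2 / δ))) =
        Real.sqrt ((2 * n) ^ 2 * (W / n + vstar p / n * Real.log (2 / δ))) := by
      rw [Real.sqrt_mul (by positivity), Real.sqrt_sq (by positivity)]; ring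
    rw [this]
    apply Real.sqrt_le_sqrt
    have h5 : (2 * (n : ℝ)) ^ 2 * (W / n + vstar p / n * Real.log (2 / δ)) =
        2 * n * (2 * W + 2 * (vstar p * Real.log (2 / δ))) := by field_simp
    rw [h5, mul_assoc]
    apply mul_le_mul_of_nonneg_left _ (by positivity)
    have h6 := mul_le_mul_of_nonneg_left h1 hv0
    have h7 := mul_le_mul_of_nonneg_right hvs hL
    have h8 := mul_nonneg hv0 hL
    linarith
  rw [← mul_le_mul_iff_right₀ hn0]
  refine hd.trans ?_
  rw [mul_add]
  refine add_le_add hsq ?_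
  have : (n : ℝ) * (4 / (3 * n) * Real.log (2 * (n + 1) / δ)) =
      4 / 3 * Real.log (2 * (n + 1) / δ) := by field_simp
  rw [this]; linarith

lemma aux_far (p : PMF ℕ) (n : ℕ) (hn : 81 ≤ n) (δ : ℝ) (hδ : δ ∈ Set.Ioo (0 : ℝ) 1)
    (e : ℕ ≃ ℕ) (he : Antitone fun i => (p (e i)).toReal) (k : ℕ) (hk : n ≤ k) (x : Fin n → ℕ)
    (hx : n * mle n x (e k) ≤ 2 * Real.log n) :
    |(p (e k)).toReal - mle n x (e k)| ≤
      4 / (3 * n) * Real.log (2 * (n + 1) / δ) + Real.log n / n := by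
  have hn0 : (0 : ℝ) < n := by positivity
  have hn81 : (81 : ℝ) ≤ n := by exact_mod_cast hn
  have hkn : (n : ℝ) ≤ k := by exact_mod_cast hk
  have hlog : 1 ≤ Real.log n := by
    rw [Real.le_log_iff_exp_le hn0]; linarith [Real.exp_one_lt_d9]
  have hl2 : Real.log n ≤ Real.log (2 * (n + 1) / δ) := by
    apply Real.log_le_log hn0
    rw [le_div_iff₀ hδ.1]
    nlinarith [hδ.2]
  have hp : n * (p (e k)).toReal ≤ 1 := by
    have h := aux_rank p e he k
    rw [le_div_iff₀ (by positivity)] at h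
    nlinarith [(ENNReal.toReal_nonneg : 0 ≤ (p (e k)).toReal)]
  have hp0 : 0 ≤ n * (p (e k)).toReal := by positivity
  have hm0 : 0 ≤ n * mle n x (e k) := by unfold mle; positivity
  rw [← mul_le_mul_iff_right₀ hn0, ← abs_of_pos hn0, ← abs_mul, abs_of_pos hn0]
  have : (n : ℝ) * (4 / (3 * n) * Real.log (2 * (n + 1) / δ) + Real.log n / n) =
      4 / 3 * Real.log (2 * (n + 1) / δ) + Real.log n := by field_simp
  rw [this, abs_le, mul_sub]
  constructor <;> linarith

theorem stmt_10 (p : PMF ℕ) (n : ℕ) (hn : 81 ≤ n) (δ : ℝ) (hδ : δ ∈ Set.Ioo (0 : ℝ) 1)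
    (e : ℕ ≃ ℕ) (he : Antitone fun i => (p (e i)).toReal) :
    ENNReal.ofReal (1 - δ - 81 / n) ≤
      sampleMeasure p n {x |
        (supErr p n x ≤
            2 * Real.sqrt (Vstar p e / n + vstar p / n * Real.log (2 / δ)) +
              4 / (3 * n) * Real.log (2 * (n + 1) / δ) + Real.log n / n ∧
          2 * Real.sqrt (Vstar p e / n + vstar p / n * Real.log (2 / δ)) +
              4 / (3 * n) * Real.log (2 * (n + 1) / δ) + Real.log n / n ≤
            2 * Real.sqrt (vstar p * Real.log (1 / vstar p) / n +
                vstar p / n * Real.log (2 / δ)) +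
              4 / (3 * n) * Real.log (2 * (n + 1) / δ) + Real.log n / n) ∧
        supErr p n x ≤
          2 * Real.sqrt (vstar p * Real.log ((n : ℝ) + 1) / n +
              vstar p / n * Real.log (2 / δ)) +
            4 / (3 * n) * Real.log (2 * (n + 1) / δ) + Real.log n / n} := by

  have hn0 : (0 : ℝ) < n := by positivity
  set G := {x : Fin n → ℕ |
        (supErr p n x ≤
            2 * Real.sqrt (Vstar p e / n + vstar p / n * Real.log (2 / δ)) +
              4 / (3 * n) * Real.log (2 * (n + 1) / δ) + Real.log n / n ∧
          2 * Real.sqrt (Vstar p e / n + vstar p / n * Real.log (2 / δ)) +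
              4 / (3 * n) * Real.log (2 * (n + 1) / δ) + Real.log n / n ≤
            2 * Real.sqrt (vstar p * Real.log (1 / vstar p) / n +
                vstar p / n * Real.log (2 / δ)) +
              4 / (3 * n) * Real.log (2 * (n + 1) / δ) + Real.log n / n) ∧
        supErr p n x ≤
          2 * Real.sqrt (vstar p * Real.log ((n : ℝ) + 1) / n +
              vstar p / n * Real.log (2 / δ)) +
            4 / (3 * n) * Real.log (2 * (n + 1) / δ) + Real.log n / n} with hG
  set A := {x : Fin n → ℕ | ∃ k, k < n ∧
      auxLev p n δ e k < n * |(p (e k)).toReal - mle n x (e k)|} with hA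
  set B := {x : Fin n → ℕ | ∃ k, n ≤ k ∧ 2 * Real.log n < n * mle n x (e k)} with hB
  have hmain : ∀ x : Fin n → ℕ, x ∉ A → x ∉ B → ∀ W : ℝ,
      (∀ k, k < n → ((p (e k)).toReal * (1 - (p (e k)).toReal)) * Real.log ((k : ℝ) + 2) ≤ W) →
      supErr p n x ≤ 2 * Real.sqrt (W / n + vstar p / n * Real.log (2 / δ)) +
              4 / (3 * n) * Real.log (2 * (n + 1) / δ) + Real.log n / n := by
    intro x hxA hxB W hW
    simp only [hA, hB, Set.mem_ofPred_eq, not_exists, not_and, not_lt] at hxA hxB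
    apply ciSup_le
    intro i
    obtain ⟨k, rfl⟩ := e.surjective i
    rcases lt_or_ge k n with hk | hk
    · have h1 := aux_lev_le p n (by omega) δ hδ e k hk W _ (hW k hk) (hxA k hk)
      have : 0 ≤ Real.log n / n := div_nonneg (Real.log_natCast_nonneg n) hn0.le
      linarith
    · have h1 := aux_far p n hn δ hδ e he k hk x (hxB k hk)
      have := Real.sqrt_nonneg (W / n + vstar p / n * Real.log (2 / δ))
      linarith
  have hsub : Set.univ ⊆ G ∪ (A ∪ B) := by
    intro x _
    by_cases hxA : x ∈ A
    · exact Or.inr (Or.inl hxA)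
    by_cases hxB : x ∈ B
    · exact Or.inr (Or.inr hxB)
    refine Or.inl ⟨⟨hmain x hxA hxB _ fun k _ => aux_V_le p e he k, ?_⟩,
      hmain x hxA hxB _ fun k hk => ?_⟩
    · have := aux_V_phi p e he
      gcongr
    · have hkn : (k : ℝ) + 1 ≤ n := by exact_mod_cast hk
      have h0 : 0 ≤ vstar p := (aux_vnn p 0).trans (aux_v_le p 0)
      exact mul_le_mul (aux_v_le p _) (Real.log_le_log (by positivity) (by linarith))
        (Real.log_nonneg (by linarith [(Nat.cast_nonneg k : (0 : ℝ) ≤ k)])) h0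
  have hAm : sampleMeasure p n A ≤ ENNReal.ofReal δ := by
    rw [← ofReal_measureReal (measure_ne_top _ _)]
    exact ENNReal.ofReal_le_ofReal (aux_head p n (by omega) δ hδ e)
  have hBm : sampleMeasure p n B ≤ ENNReal.ofReal (81 / n) := aux_tail2 p n hn e he
  have h1 : 1 ≤ sampleMeasure p n G + (ENNReal.ofReal δ + ENNReal.ofReal (81 / n)) := by
    calc 1 = sampleMeasure p n Set.univ := measure_univ.symm
      _ ≤ _ := measure_mono hsub
      _ ≤ _ := measure_union_le _ _
      _ ≤ _ := by gcongr; exact (measure_union_le _ _).trans (add_le_add hAm hBm)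
  rw [← ENNReal.ofReal_add hδ.1.le (by positivity)] at h1
  rw [sub_sub, ENNReal.ofReal_sub _ (add_nonneg hδ.1.le (by positivity)), ENNReal.ofReal_one]
  exact tsub_le_iff_right.2 h1
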